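/- Let R, S and T be triangulated categories with a left recollement given by triangle functors i^* : S → R, i_* : R → S, j_! : T → S, j^* : S → T. Let G_R ∈ R, G_S ∈ S, G_T ∈ T. If Hom_S(G_S[n], G_S) = 0 for all sufficiently large n and both i_*(G_R) and j_!(G_T) lie in ⟨G_S⟩, then fd(S, G_S) ≤ fd(R, G_R) + fd(T, G_T) + w_{G_S}(i_*(G_R)) + w_{G_S}(j_!(G_T)) + o^-(G_S) + 1. In particular, if fd(R, G_R) and fd(T, G_T) are both finite, then so is fd(S, G_S). -/

import Mathlib

/-! Core definitions for homological dimensions in triangulated categories,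
following Chen–Chen–Zhang, "Finiteness of homological dimensions in
triangulated categories". -/

open CategoryTheory CategoryTheory.Limits CategoryTheory.Pretriangulated

universe v u

namespace TriFD

/-- Cast of an integer to `EReal` (= `ℤ ∪ {±∞}`, embedded in the extended reals). -/
noncomputable def ec (n : ℤ) : EReal := ((n : ℝ) : EReal)

/-- Cast of a natural number to `EReal`. -/
noncomputable def en (n : ℕ) : EReal := ((n : ℝ) : EReal)

variable {C : Type u} [Category.{v} C] [HasZeroObject C] [HasShift C ℤ]
  [Preadditive C] [∀ n : ℤ, (shiftFunctor C n).Additive] [Pretriangulated C]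

/-- `Hom(A, B) = 0`. -/
def homZero (A B : C) : Prop := ∀ f : A ⟶ B, f = 0

/-- `smd 𝒜`: the closure of `𝒜` under direct summands (retracts). -/
def smdSet (A : Set C) : Set C :=
  {X | ∃ Y ∈ A, ∃ (s : X ⟶ Y) (r : Y ⟶ X), s ≫ r = 𝟙 X}

/-- `𝒜 ∗ ℬ`: the full subcategory of objects `Z` sitting in a distinguished triangle
`X → Z → Y → X⟦1⟧` with `X ∈ 𝒜`, `Y ∈ ℬ`. -/
def extSet (A B : Set C) : Set C :=
  {Z | ∃ (X : C) (_ : X ∈ A) (Y : C) (_ : Y ∈ B) (f : X ⟶ Z) (g : Z ⟶ Y) (h : Y ⟶ X⟦(1 : ℤ)⟧),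
    Triangle.mk f g h ∈ distTriang C}

/-- The closure `add 𝒜` of `𝒜` under finite direct sums (a direct sum being witnessed by a
split distinguished triangle). -/
inductive addP (A : Set C) : C → Prop
  | of {X : C} : X ∈ A → addP A X
  | zero {X : C} : IsZero X → addP A X
  | sum {X Z Y : C} (f : X ⟶ Z) (g : Z ⟶ Y) :
      addP A X → addP A Y → (Triangle.mk f g (0 : Y ⟶ X⟦(1 : ℤ)⟧) ∈ distTriang C) → addP A Z

/-- `add 𝒜` as a set. -/
def addSet (A : Set C) : Set C := setOf (addP A)

/-- `coprodIter 𝒜 n = coprod_{n+1}(𝒜)`, i.e. `coprod_1 = add 𝒜` and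
`coprod_{n+1} = add 𝒜 ∗ coprod_n`. -/
def coprodIter (A : Set C) : ℕ → Set C
  | 0 => addSet A
  | n + 1 => extSet (addSet A) (coprodIter A n)

/-- `Add 𝒜`: the closure of `𝒜` under arbitrary (small) coproducts. -/
def AddSet (A : Set C) : Set C :=
  {X | ∃ (ι : Type v) (f : ι → C) (_ : ∀ i, f i ∈ A) (c : Cofan f),
      Nonempty (IsColimit c) ∧ X = c.pt}

/-- `CoprodIter 𝒜 n = Coprod_{n+1}(𝒜)`, i.e. `Coprod_1 = Add 𝒜` and
`Coprod_{n+1} = Add 𝒜 ∗ Coprod_n`. -/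
def CoprodIter (A : Set C) : ℕ → Set C
  | 0 => AddSet A
  | n + 1 => extSet (AddSet A) (CoprodIter A n)

/-- `Coprod(𝒜)`: the smallest full subcategory of `C` containing `𝒜` and closed under
(small) coproducts and extensions. -/
inductive CoprodP (A : Set C) : C → Prop
  | of {X : C} : X ∈ A → CoprodP A X
  | zero {X : C} : IsZero X → CoprodP A X
  | coprod {ι : Type v} (f : ι → C) (c : Cofan f) :
      (∀ i, CoprodP A (f i)) → Nonempty (IsColimit c) → CoprodP A c.pt
  | ext {X Z Y : C} (f : X ⟶ Z) (g : Z ⟶ Y) (h : Y ⟶ X⟦(1 : ℤ)⟧) :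
      CoprodP A X → CoprodP A Y → (Triangle.mk f g h ∈ distTriang C) → CoprodP A Z

/-- `Coprod(𝒜)` as a set. -/
def CoprodSet (A : Set C) : Set C := setOf (CoprodP A)

/-- `G[p] = { G[-i] ∣ i ∈ ℤ, p i }`; e.g. `G[A,B]` corresponds to `p i = (A ≤ i ∧ i ≤ B)`. -/
def shiftsOf (G : C) (p : ℤ → Prop) : Set C := {X | ∃ i : ℤ, p i ∧ X = G⟦(-i : ℤ)⟧}

/-- `⟨G⟩^{p}_{n+1} = smd (coprod_{n+1} (G[p]))`. -/
def sClGr (G : C) (p : ℤ → Prop) (n : ℕ) : Set C := smdSet (coprodIter (shiftsOf G p) n)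

/-- `⟨G⟩^{p} = ⋃ₙ ⟨G⟩^{p}_n`; for `p = ⊤` this is `⟨G⟩`, the smallest full triangulated
subcategory of `C` containing `G` and closed under direct summands. -/
def sCl (G : C) (p : ℤ → Prop) : Set C := ⋃ n : ℕ, sClGr G p n

/-- `⟨G⟩bar^{p}_{n+1} = smd (Coprod_{n+1} (G[p]))`. -/
def bClGr (G : C) (p : ℤ → Prop) (n : ℕ) : Set C := smdSet (CoprodIter (shiftsOf G p) n)

/-- `⟨G⟩bar^{p} = smd (Coprod (G[p]))`. -/
def bCl (G : C) (p : ℤ → Prop) : Set C := smdSet (CoprodSet (shiftsOf G p))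

/-- The shift `𝒜[n]` of a subcategory (up to isomorphism). -/
def shiftSet (A : Set C) (n : ℤ) : Set C := {X | ∃ Y ∈ A, Nonempty (X ≅ Y⟦n⟧)}

/-- The finitistic dimension of the full (triangulated) subcategory of objects satisfying `P`
at an object `G`:
`fd = inf { n ∈ ℕ ∣ G(-∞,-1]^⊥ ⊆ ⟨G⟩^{[0,+∞)}[n] }` (computed among objects of `P`). -/
noncomputable def fdRel (P : Set C) (G : C) : EReal :=
  sInf {x : EReal | ∃ n : ℕ, x = en n ∧
    ∀ X ∈ P, (∀ m : ℤ, 1 ≤ m → homZero (G⟦m⟧) X) →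
      X ∈ shiftSet (sCl G (fun i => 0 ≤ i)) (n : ℤ)}

/-- The finitistic dimension `fd(C, G)` of `C` at `G`. -/
noncomputable def fd (G : C) : EReal := fdRel Set.univ G

/-- The width `w_G(P) = min { β - α ∣ P ∈ ⟨G⟩^{[α,β]} }` (junk value `0` when no such
interval exists). -/
noncomputable def width (G P : C) : ℕ :=
  sInf {d : ℕ | ∃ a b : ℤ, b - a = (d : ℤ) ∧ P ∈ sCl G (fun i => a ≤ i ∧ i ≤ b)}

/-- The big width `wbar_G(P) = min { β - α ∣ P ∈ ⟨G⟩bar^{[α,β]} }`. -/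
noncomputable def bwidth (G P : C) : ℕ :=
  sInf {d : ℕ | ∃ a b : ℤ, b - a = (d : ℤ) ∧ P ∈ bCl G (fun i => a ≤ i ∧ i ≤ b)}

/-- The lower self-orthogonal index `o⁻(G) = inf { b ≥ 0 ∣ Hom(G[i], G) = 0 for all i > b }`. -/
noncomputable def oMinus (G : C) : EReal :=
  sInf {x : EReal | ∃ b : ℕ, x = en b ∧ ∀ i : ℤ, (b : ℤ) < i → homZero (G⟦i⟧) G}

/-- The upper self-orthogonal index `o⁺(G) = inf { c ≥ 0 ∣ Hom(G, G[i]) = 0 for all i > c }`. -/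
noncomputable def oPlus (G : C) : EReal :=
  sInf {x : EReal | ∃ c : ℕ, x = en c ∧ ∀ i : ℤ, (c : ℤ) < i → homZero G (G⟦i⟧)}

/-- The aisle `C_G^{≤ n} = Coprod (G(-∞, n])` of the `t`-structure generated by the
compact object `G` (the description for general `n` agreeing, up to the canonical
identifications, with `C_G^{≤0}[-n]`). -/
def tLE (G : C) (n : ℤ) : Set C := CoprodSet (shiftsOf G (fun i => i ≤ n))

/-- The coaisle `C_G^{≥ n}` of the `t`-structure generated by the compact object `G`:
`C_G^{≥ 1} = (G(-∞,0])^⊥ = { X ∣ Hom(G⟦i⟧, X) = 0 for all i ≥ 0 }`, and in general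
`C_G^{≥ n} = { X ∣ Hom(G⟦i⟧, X) = 0 for all i ≥ 1 - n }`. -/
def tGE (G : C) (n : ℤ) : Set C := {X | ∀ i : ℤ, 1 - n ≤ i → homZero (G⟦i⟧) X}

/-- Bounded above objects `C^- = ⋃ₘ C^{≤ m}`. -/
def tMinus (G : C) : Set C := ⋃ m : ℕ, tLE G (m : ℤ)

/-- Bounded below objects `C^+ = ⋃ₘ C^{≥ -m}`. -/
def tPlus (G : C) : Set C := ⋃ m : ℕ, tGE G (-(m : ℤ))

/-- Bounded objects `C^b = C^- ∩ C^+`. -/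
def tB (G : C) : Set C := tMinus G ∩ tPlus G

/-- An object `X` is compact if `Hom(X, -)` commutes with (small) coproducts. -/
def IsCompactObj (X : C) : Prop :=
  ∀ ι : Type v, Nonempty (PreservesColimitsOfShape (Discrete ι) (coyoneda.obj (Opposite.op X)))

/-- `G` is a compact generator of `C` if `G` is compact and `C = ⟨G⟩bar^{(-∞,+∞)}`. -/
def IsCompactGenerator (G : C) : Prop :=
  IsCompactObj G ∧ ∀ X : C, X ∈ bCl G (fun _ => True)

/-- The projective dimension of `X` with respect to `G`:
`pd_G(X) = inf { n ∈ ℤ ∣ Hom(X, Y[i]) = 0 for all i > n and Y ∈ C^b ∩ C^{≤ 0} }`. -/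
noncomputable def pd (G X : C) : EReal :=
  sInf {x : EReal | ∃ n : ℤ, x = ec n ∧
    ∀ Y : C, Y ∈ tB G → Y ∈ tLE G 0 → ∀ i : ℤ, n < i → homZero X (Y⟦i⟧)}

/-- The finitistic dimension
`fpd(C, G) = sup { pd_G(X) ∣ X ∈ C^c ∩ C^b ∩ C^{≥ 0}, pd_G(X) < +∞ }`. -/
noncomputable def fpd (G : C) : EReal :=
  sSup {x : EReal | ∃ X : C,
    IsCompactObj X ∧ X ∈ tB G ∧ X ∈ tGE G 0 ∧ pd G X < ⊤ ∧ x = pd G X}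

/-- The big finitistic dimension
`Fpd(C, G) = sup { pd_G(X) ∣ X ∈ C^b ∩ C^{≥ 0}, pd_G(X) < +∞ }`. -/
noncomputable def Fpd (G : C) : EReal :=
  sSup {x : EReal | ∃ X : C, X ∈ tB G ∧ X ∈ tGE G 0 ∧ pd G X < ⊤ ∧ x = pd G X}

/-- The global dimension `gpd(C, G) = sup { pd_G(X) ∣ X ∈ C^b ∩ C^{≥ 0} }`. -/
noncomputable def gpd (G : C) : EReal :=
  sSup {x : EReal | ∃ X : C, X ∈ tB G ∧ X ∈ tGE G 0 ∧ x = pd G X}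

/-- The approximable index `b(M)` of `M ∈ C^{≤0}`: the least `n ≥ 0` such that there is a
distinguished triangle `E → M → D → E⟦1⟧` with `E ∈ ⟨G⟩bar^{[-n,n]}` and `D ∈ C^{≤ -1}`. -/
noncomputable def bIdx (G M : C) : EReal :=
  sInf {x : EReal | ∃ n : ℕ, x = en n ∧
    ∃ (E D : C) (_ : E ∈ bCl G (fun i => -(n : ℤ) ≤ i ∧ i ≤ (n : ℤ))) (_ : D ∈ tLE G (-1))
      (f : E ⟶ M) (g : M ⟶ D) (h : D ⟶ E⟦(1 : ℤ)⟧), Triangle.mk f g h ∈ distTriang C}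

/-- The `G`-approximable index `a(G) = sup { b(M) ∣ M ∈ C^{≤ 0} }`. -/
noncomputable def aIdx (G : C) : EReal :=
  sSup {x : EReal | ∃ M ∈ tLE G 0, x = bIdx G M}

/-- `C` is weakly approximable, as witnessed by the compact generator `G` (and the
`t`-structure generated by `G`, which lies in the preferred equivalence class). -/
def IsWeaklyApproximable (G : C) : Prop :=
  IsCompactGenerator G ∧ ∃ A : ℕ, 0 < A ∧
    G⟦(A : ℤ)⟧ ∈ tLE G 0 ∧
    (∀ Y ∈ tLE G 0, homZero (G⟦-(A : ℤ)⟧) Y) ∧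
    ∀ F ∈ tLE G 0, ∃ (E D : C) (_ : E ∈ bCl G (fun i => -(A : ℤ) ≤ i ∧ i ≤ (A : ℤ)))
      (_ : D ∈ tLE G (-1)) (f : E ⟶ F) (g : F ⟶ D) (h : D ⟶ E⟦(1 : ℤ)⟧),
        Triangle.mk f g h ∈ distTriang C

/-- `C` is approximable, as witnessed by the compact generator `G`. -/
def IsApproximable (G : C) : Prop :=
  IsCompactGenerator G ∧ ∃ A : ℕ, 0 < A ∧
    G⟦(A : ℤ)⟧ ∈ tLE G 0 ∧
    (∀ Y ∈ tLE G 0, homZero (G⟦-(A : ℤ)⟧) Y) ∧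
    ∀ F ∈ tLE G 0, ∃ (E D : C) (_ : E ∈ bClGr G (fun i => -(A : ℤ) ≤ i ∧ i ≤ (A : ℤ)) (A - 1))
      (_ : D ∈ tLE G (-1)) (f : E ⟶ F) (g : F ⟶ D) (h : D ⟶ E⟦(1 : ℤ)⟧),
        Triangle.mk f g h ∈ distTriang C

/-- Strongly bounded objects: `C^sb = ⋃_{i ≥ 0} ⟨G⟩bar^{[-i,i]}`. -/
def sSB (G : C) : Set C := ⋃ i : ℕ, bCl G (fun k => -(i : ℤ) ≤ k ∧ k ≤ (i : ℤ))

/-- A pair of full subcategories `(L, R)` is a `t`-structure. -/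
def IsTStructurePair (L Rt : Set C) : Prop :=
  (∀ X ∈ L, X⟦(1 : ℤ)⟧ ∈ L) ∧ (∀ X ∈ Rt, X⟦(-1 : ℤ)⟧ ∈ Rt) ∧
  (∀ X ∈ L, ∀ Y ∈ Rt, homZero X Y) ∧
  ∀ X : C, ∃ (A B : C) (_ : A ∈ L) (_ : B ∈ Rt) (f : A ⟶ X) (g : X ⟶ B) (h : B ⟶ A⟦(1 : ℤ)⟧),
    Triangle.mk f g h ∈ distTriang C

/-- `M` is a silting object: `(M[1,+∞)^⊥, M(-∞,0]^⊥)` is a `t`-structure. -/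
def IsSilting (M : C) : Prop :=
  IsTStructurePair {X | ∀ i : ℤ, 1 ≤ i → homZero (M⟦(-i : ℤ)⟧) X}
    {X | ∀ i : ℤ, i ≤ 0 → homZero (M⟦(-i : ℤ)⟧) X}

/-- `M` is a tilting object: `M` is silting and `Hom(M', M[i]) = 0` for every `i ≠ 0` and
every direct summand `M'` of a coproduct of copies of `M`. -/
def IsTilting (M : C) : Prop :=
  IsSilting M ∧ ∀ i : ℤ, i ≠ 0 → ∀ M' ∈ smdSet (AddSet {M}), homZero M' (M⟦i⟧)


/-! ### Exactness and extensions in pretriangulated categories -/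

section Exactness

variable {A B D A' B' D' X : C} {f : A ⟶ B} {g : B ⟶ D} {h : D ⟶ A⟦(1 : ℤ)⟧}
  {f' : A' ⟶ B'} {g' : B' ⟶ D'} {h' : D' ⟶ A'⟦(1 : ℤ)⟧}

lemma exists_desc₂ (hT : Triangle.mk f g h ∈ distTriang C) (x : B ⟶ X) (hx : f ≫ x = 0) :
    ∃ y : D ⟶ X, g ≫ y = x := by
  obtain ⟨y, hy⟩ := Triangle.yoneda_exact₂ _ hT x hx
  exact ⟨y, hy.symm⟩

lemma exists_desc₃ (hT : Triangle.mk f g h ∈ distTriang C) (x : D ⟶ X) (hx : g ≫ x = 0) :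
    ∃ y : A⟦(1 : ℤ)⟧ ⟶ X, h ≫ y = x := by
  obtain ⟨y, hy⟩ := Triangle.yoneda_exact₃ _ hT x hx
  exact ⟨y, hy.symm⟩

lemma exists_lift₂ (hT : Triangle.mk f g h ∈ distTriang C) (x : X ⟶ B) (hx : x ≫ g = 0) :
    ∃ y : X ⟶ A, y ≫ f = x := by
  obtain ⟨y, hy⟩ := Triangle.coyoneda_exact₂ _ hT x hx
  exact ⟨y, hy.symm⟩

lemma exists_hom₁ (hT : Triangle.mk f g h ∈ distTriang C)
    (hT' : Triangle.mk f' g' h' ∈ distTriang C)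
    (b : B ⟶ B') (c : D ⟶ D') (w : g ≫ c = b ≫ g') :
    ∃ a : A ⟶ A', f ≫ b = a ≫ f' ∧ h ≫ a⟦(1 : ℤ)⟧' = c ≫ h' :=
  complete_distinguished_triangle_morphism₁ _ _ hT hT' b c w

lemma exists_hom₂ (hT : Triangle.mk f g h ∈ distTriang C)
    (hT' : Triangle.mk f' g' h' ∈ distTriang C)
    (a : A ⟶ A') (c : D ⟶ D') (w : h ≫ a⟦(1 : ℤ)⟧' = c ≫ h') :
    ∃ b : B ⟶ B', f ≫ b = a ≫ f' ∧ g ≫ c = b ≫ g' :=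
  complete_distinguished_triangle_morphism₂ _ _ hT hT' a c w

lemma exists_hom₃ (hT : Triangle.mk f g h ∈ distTriang C)
    (hT' : Triangle.mk f' g' h' ∈ distTriang C)
    (a : A ⟶ A') (b : B ⟶ B') (w : f ≫ b = a ≫ f') :
    ∃ c : D ⟶ D', g ≫ c = b ≫ g' ∧ h ≫ a⟦(1 : ℤ)⟧' = c ≫ h' :=
  complete_distinguished_triangle_morphism _ _ hT hT' a b w

lemma mk_rotate (hT : Triangle.mk f g h ∈ distTriang C) :
    Triangle.mk g h (-f⟦(1 : ℤ)⟧') ∈ distTriang C :=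
  rot_of_distTriang _ hT

lemma exists_ext₁ (hT : Triangle.mk f g h ∈ distTriang C) (y : A ⟶ X)
    (hy : h ≫ y⟦(1 : ℤ)⟧' = 0) : ∃ z : B ⟶ X, f ≫ z = y := by
  obtain ⟨z, hz, -⟩ := exists_hom₂ hT (contractible_distinguished X) y 0 (by rw [hy, zero_comp])
  exact ⟨z, by rw [hz, Category.comp_id]⟩

/-- An endomorphism of the middle object of a distinguished triangle which is compatible with the
identities of the outer objects is a split monomorphism. -/
lemma exists_comp_eq_id_of_comp_eq (hT : Triangle.mk f g h ∈ distTriang C) (w : B ⟶ B)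
    (hf : f ≫ w = f) (hg : w ≫ g = g) : ∃ w' : B ⟶ B, w ≫ w' = 𝟙 B := by
  obtain ⟨r, hr⟩ := exists_lift₂ hT (𝟙 B - w) (by rw [Preadditive.sub_comp, hg]; simp)
  have hsq : (𝟙 B - w) ≫ (𝟙 B - w) = 0 := by
    nth_rw 1 [← hr]
    simp [Preadditive.comp_sub, hf]
  refine ⟨𝟙 B + (𝟙 B - w), ?_⟩
  have : w = 𝟙 B - (𝟙 B - w) := by abel
  rw [this]
  generalize 𝟙 B - w = n at hsq
  simp [Preadditive.comp_add, Preadditive.sub_comp, hsq]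

end Exactness

/-- Without assuming octahedra, an object of `(X ∗ Y) ∗ Z` is a retract of an object of
`X ∗ (Y ∗ Z)`. -/
lemma exists_retract_of_extension_assoc {X V Y W Z : C}
    {i : X ⟶ V} {p : V ⟶ Y} {h : Y ⟶ X⟦(1 : ℤ)⟧} (hV : Triangle.mk i p h ∈ distTriang C)
    {a : V ⟶ W} {b : W ⟶ Z} {c : Z ⟶ V⟦(1 : ℤ)⟧} (hW : Triangle.mk a b c ∈ distTriang C) :
    ∃ (E W' : C) (d : Y ⟶ E) (e : E ⟶ Z) (k : Z ⟶ Y⟦(1 : ℤ)⟧)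
      (_ : Triangle.mk d e k ∈ distTriang C)
      (i' : X ⟶ W') (p' : W' ⟶ E) (h' : E ⟶ X⟦(1 : ℤ)⟧)
      (_ : Triangle.mk i' p' h' ∈ distTriang C)
      (s : W ⟶ W') (r : W' ⟶ W), s ≫ r = 𝟙 W := by
  have hip : i ≫ p = 0 := comp_distTriang_mor_zero₁₂ _ hV
  have hca : c ≫ a⟦(1 : ℤ)⟧' = 0 := comp_distTriang_mor_zero₃₁ _ hW
  obtain ⟨E, d, e, hE⟩ := distinguished_cocone_triangle₂ (c ≫ p⟦(1 : ℤ)⟧')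
  obtain ⟨D, q, δ, hD⟩ := distinguished_cocone_triangle (i ≫ a)
  have hδ : δ ≫ (i ≫ a)⟦(1 : ℤ)⟧' = 0 := comp_distTriang_mor_zero₃₁ _ hD
  obtain ⟨g, hg₁, hg₂⟩ := exists_hom₂ hW hE p (𝟙 Z) (by rw [Category.id_comp])
  rw [Category.comp_id] at hg₂
  obtain ⟨y, hy, -⟩ := exists_hom₃ hV hD (𝟙 X) a (by rw [Category.id_comp])
  obtain ⟨θ, hθ⟩ := exists_desc₂ hD g (by rw [Category.assoc, hg₁, reassoc_of% hip, zero_comp])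
  obtain ⟨ρ, hρ⟩ := exists_ext₁ hE y (by
    rw [Category.assoc, ← Functor.map_comp, hy, Functor.map_comp, reassoc_of% hca, zero_comp])
  obtain ⟨ν, hν⟩ := exists_desc₂ hW (g ≫ ρ - q) (by
    rw [Preadditive.comp_sub, reassoc_of% hg₁, hρ, hy, sub_self])
  -- `W ⟶ D` and `W ⟶ E` factor through each other
  obtain ⟨θ', hθ'⟩ : ∃ θ' : E ⟶ D, g ≫ θ' = q := by
    refine ⟨ρ - e ≫ ν, ?_⟩
    rw [Preadditive.comp_sub, ← reassoc_of% hg₂, hν]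
    abel
  obtain ⟨κ, hκ⟩ := exists_desc₃ hD (𝟙 D - θ ≫ θ') (by
    rw [Preadditive.comp_sub, reassoc_of% hθ, hθ', Category.comp_id, sub_self])
  have hθθ' : θ ≫ θ' = 𝟙 D - δ ≫ κ := by rw [hκ]; abel
  obtain ⟨W', i', p', hW'⟩ := distinguished_cocone_triangle₂ (θ' ≫ δ)
  obtain ⟨s, hs₁, hs₂⟩ := exists_hom₁ (mk_rotate hD) (mk_rotate hW') θ (𝟙 _ - κ ≫ δ) (by
    rw [reassoc_of% hθθ']
    simp [Preadditive.comp_sub, Preadditive.sub_comp])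
  obtain ⟨r, hr₁, hr₂⟩ := exists_hom₂ hW' hD (𝟙 X) θ' (by
    rw [CategoryTheory.Functor.map_id, Category.comp_id])
  have hqs : (s ≫ r) ≫ q = q := by
    rw [Category.assoc, ← hr₂, ← reassoc_of% hs₁, reassoc_of% hθ, hθ']
  have his : (i ≫ a) ≫ s ≫ r = i ≫ a := by
    apply (shiftFunctor C (1 : ℤ)).map_injective
    have h₁ : (i ≫ a)⟦(1 : ℤ)⟧' ≫ s⟦(1 : ℤ)⟧' = (𝟙 _ - κ ≫ δ) ≫ i'⟦(1 : ℤ)⟧' := by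
      rw [Preadditive.neg_comp, Preadditive.comp_neg] at hs₂
      exact neg_injective hs₂
    have h₂ : i'⟦(1 : ℤ)⟧' ≫ r⟦(1 : ℤ)⟧' = (i ≫ a)⟦(1 : ℤ)⟧' := by
      rw [← Functor.map_comp, hr₁, Category.id_comp]
    rw [Functor.map_comp, Functor.map_comp _ s r, reassoc_of% h₁, h₂, Preadditive.sub_comp,
      Category.assoc, hδ, Category.id_comp, comp_zero, sub_zero]
  obtain ⟨w', hw'⟩ := exists_comp_eq_id_of_comp_eq hD (s ≫ r) his hqs
  exact ⟨E, W', d, e, _, hE, i', p', _, hW', s, r ≫ w', by rw [← Category.assoc, hw']⟩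

/-- An extension of retracts is a retract of an extension. -/
lemma exists_retract_of_extension_of_retracts {X X' Y Y' Z : C}
    {f : X ⟶ Z} {g : Z ⟶ Y} {h : Y ⟶ X⟦(1 : ℤ)⟧} (hT : Triangle.mk f g h ∈ distTriang C)
    (sX : X ⟶ X') (rX : X' ⟶ X) (hX : sX ≫ rX = 𝟙 X)
    (sY : Y ⟶ Y') (rY : Y' ⟶ Y) (hY : sY ≫ rY = 𝟙 Y) :
    ∃ (Z' : C) (f' : X' ⟶ Z') (g' : Z' ⟶ Y') (h' : Y' ⟶ X'⟦(1 : ℤ)⟧)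
      (_ : Triangle.mk f' g' h' ∈ distTriang C) (s : Z ⟶ Z') (r : Z' ⟶ Z), s ≫ r = 𝟙 Z := by
  obtain ⟨Z', f', g', hT'⟩ := distinguished_cocone_triangle₂ (rY ≫ h ≫ sX⟦(1 : ℤ)⟧')
  obtain ⟨s, hs₁, hs₂⟩ := exists_hom₂ hT hT' sX sY (by rw [reassoc_of% hY])
  obtain ⟨r, hr₁, hr₂⟩ := exists_hom₂ hT' hT rX rY (by
    rw [Category.assoc, Category.assoc, ← Functor.map_comp, hX,
      CategoryTheory.Functor.map_id, Category.comp_id])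
  obtain ⟨w', hw'⟩ := exists_comp_eq_id_of_comp_eq hT (s ≫ r)
    (by rw [reassoc_of% hs₁, hr₁, reassoc_of% hX])
    (by rw [Category.assoc, ← hr₂, ← reassoc_of% hs₂, hY, Category.comp_id])
  exact ⟨Z', f', g', _, hT', s, r ≫ w', by rw [← Category.assoc, hw']⟩

/-! ### Classes closed under extensions and direct summands -/

/-- `Q` contains the zero objects and is closed under direct summands and extensions. -/
structure IsExtClosed (Q : Set C) : Prop where
  zero : ∀ {X : C}, IsZero X → X ∈ Q
  retract : ∀ {X Y : C} (s : X ⟶ Y) (r : Y ⟶ X), s ≫ r = 𝟙 X → Y ∈ Q → X ∈ Q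
  ext : ∀ {X Z Y : C} (f : X ⟶ Z) (g : Z ⟶ Y) (h : Y ⟶ X⟦(1 : ℤ)⟧),
    Triangle.mk f g h ∈ distTriang C → X ∈ Q → Y ∈ Q → Z ∈ Q

lemma IsExtClosed.of_iso {Q : Set C} (hQ : IsExtClosed Q) {X Y : C} (e : X ≅ Y) (hX : X ∈ Q) :
    Y ∈ Q :=
  hQ.retract e.inv e.hom e.inv_hom_id hX

lemma mem_sCl_iff {G X : C} {p : ℤ → Prop} : X ∈ sCl G p ↔ ∃ n, X ∈ sClGr G p n :=
  Set.mem_iUnion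

lemma sCl_retract {G X Y : C} {p : ℤ → Prop} (s : X ⟶ Y) (r : Y ⟶ X) (hsr : s ≫ r = 𝟙 X)
    (hY : Y ∈ sCl G p) : X ∈ sCl G p := by
  obtain ⟨n, Y', hY', s', r', h'⟩ := mem_sCl_iff.1 hY
  exact mem_sCl_iff.2 ⟨n, Y', hY', s ≫ s', r' ≫ r, by
    rw [Category.assoc, reassoc_of% h', hsr]⟩

lemma coprodIter_subset_sCl {G : C} {p : ℤ → Prop} {n : ℕ} :
    coprodIter (shiftsOf G p) n ⊆ sCl G p :=
  fun X hX => mem_sCl_iff.2 ⟨n, X, hX, 𝟙 X, 𝟙 X, Category.comp_id _⟩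

lemma sCl_ext_of_mem_addSet {G X Z Y : C} {p : ℤ → Prop} {f : X ⟶ Z} {g : Z ⟶ Y}
    {h : Y ⟶ X⟦(1 : ℤ)⟧} (hT : Triangle.mk f g h ∈ distTriang C)
    (hX : X ∈ addSet (shiftsOf G p)) (hY : Y ∈ sCl G p) : Z ∈ sCl G p := by
  obtain ⟨n, Y', hY', s, r, hsr⟩ := mem_sCl_iff.1 hY
  obtain ⟨Z', f', g', h', hT', s', r', h''⟩ :=
    exists_retract_of_extension_of_retracts hT (𝟙 X) (𝟙 X) (Category.comp_id _) s r hsr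
  exact mem_sCl_iff.2 ⟨n + 1, Z', ⟨X, hX, Y', hY', f', g', h', hT'⟩, s', r', h''⟩

lemma sCl_ext_of_mem_coprodIter {G : C} {p : ℤ → Prop} (n : ℕ) : ∀ {X Z Y : C} {f : X ⟶ Z}
    {g : Z ⟶ Y} {h : Y ⟶ X⟦(1 : ℤ)⟧}, Triangle.mk f g h ∈ distTriang C →
    X ∈ coprodIter (shiftsOf G p) n → Y ∈ sCl G p → Z ∈ sCl G p := by
  induction n with
  | zero => exact fun hT hX hY => sCl_ext_of_mem_addSet hT hX hY
  | succ n ih =>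
    rintro X Z Y f g h hT ⟨A, hA, B, hB, i, q, k, hX⟩ hY
    obtain ⟨E, W', d, e, _, hE, i', p', h', hW', s, r, hsr⟩ :=
      exists_retract_of_extension_assoc hX hT
    exact sCl_retract s r hsr (sCl_ext_of_mem_addSet hW' hA (ih hE hB hY))

lemma isExtClosed_sCl (G : C) (p : ℤ → Prop) : IsExtClosed (sCl G p) where
  zero hX := coprodIter_subset_sCl (n := 0) (addP.zero hX)
  retract := sCl_retract
  ext f g h hT hX hY := by
    obtain ⟨n, X', hX', s, r, hsr⟩ := mem_sCl_iff.1 hX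
    obtain ⟨Z', f', g', h', hT', s', r', h''⟩ :=
      exists_retract_of_extension_of_retracts hT s r hsr (𝟙 _) (𝟙 _) (Category.comp_id _)
    exact sCl_retract s' r' h'' (sCl_ext_of_mem_coprodIter n hT' hX' hY)

lemma shift_mem_sCl {G : C} {p : ℤ → Prop} {i : ℤ} (hi : p i) : G⟦(-i : ℤ)⟧ ∈ sCl G p :=
  coprodIter_subset_sCl (n := 0) (addP.of ⟨i, hi, rfl⟩)

lemma sCl_subset {G : C} {p : ℤ → Prop} {Q : Set C} (hQ : IsExtClosed Q)
    (hG : ∀ i, p i → G⟦(-i : ℤ)⟧ ∈ Q) : sCl G p ⊆ Q := by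
  have hadd : addSet (shiftsOf G p) ⊆ Q := by
    intro X hX
    induction hX with
    | of h => obtain ⟨i, hi, rfl⟩ := h; exact hG i hi
    | zero h => exact hQ.zero h
    | sum f g _ _ hT hX hY => exact hQ.ext f g 0 hT hX hY
  have hiter (n : ℕ) : coprodIter (shiftsOf G p) n ⊆ Q := by
    induction n with
    | zero => exact hadd
    | succ n ih =>
      rintro Z ⟨X, hX, Y, hY, f, g, h, hT⟩
      exact hQ.ext f g h hT (hadd hX) (ih hY)
  intro X hX
  obtain ⟨n, Y, hY, s, r, hsr⟩ := mem_sCl_iff.1 hX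
  exact hQ.retract s r hsr (hiter n hY)

lemma sCl_mono {G : C} {p q : ℤ → Prop} (hpq : ∀ i, p i → q i) : sCl G p ⊆ sCl G q :=
  sCl_subset (isExtClosed_sCl G q) fun i hi => shift_mem_sCl (hpq i hi)

lemma IsExtClosed.preimage {D : Type*} [Category* D] [HasZeroObject D] [HasShift D ℤ]
    [Preadditive D] [∀ n : ℤ, (shiftFunctor D n).Additive] [Pretriangulated D]
    {Q : Set D} (hQ : IsExtClosed Q) (F : C ⥤ D) [F.CommShift ℤ] [F.IsTriangulated] :
    IsExtClosed {X | F.obj X ∈ Q} where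
  zero hX := hQ.zero (F.map_isZero hX)
  retract s r hsr hY := hQ.retract (F.map s) (F.map r) (by rw [← F.map_comp, hsr, F.map_id]) hY
  ext f g h hT hX hY := hQ.ext _ _ _ (F.map_distinguished _ hT) hX hY

lemma IsExtClosed.shift_preimage {Q : Set C} (hQ : IsExtClosed Q) (n : ℤ) :
    IsExtClosed {X : C | X⟦n⟧ ∈ Q} where
  zero hX := hQ.zero ((shiftFunctor C n).map_isZero hX)
  retract s r hsr hY := hQ.retract (s⟦n⟧') (r⟦n⟧')
    (by rw [← Functor.map_comp, hsr, CategoryTheory.Functor.map_id]) hY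
  ext f g h hT hX hY := hQ.ext _ _ _ (Triangle.shift_distinguished _ hT n) hX hY

lemma shift_mem_sCl_of_eq {G : C} {p : ℤ → Prop} (a b : ℤ) (h : p (-(a + b))) :
    (G⟦a⟧)⟦b⟧ ∈ sCl G p :=
  (isExtClosed_sCl G p).of_iso ((shiftFunctorAdd' C a b (- -(a + b)) (neg_neg _).symm).app G)
    (shift_mem_sCl h)

lemma sCl_shift {G X : C} {p q : ℤ → Prop} (n : ℤ) (hpq : ∀ i, p i → q (i - n))
    (hX : X ∈ sCl G p) : X⟦n⟧ ∈ sCl G q :=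
  sCl_subset ((isExtClosed_sCl G q).shift_preimage n)
    (fun i hi => shift_mem_sCl_of_eq _ _ (by convert hpq i hi using 1; ring)) hX

lemma sCl_shift_iff {G X : C} {p q : ℤ → Prop} (n : ℤ) (hpq : ∀ i, p i ↔ q (i - n)) :
    X⟦n⟧ ∈ sCl G q ↔ X ∈ sCl G p := by
  refine ⟨fun hX => ?_, sCl_shift n fun i hi => (hpq i).1 hi⟩
  refine (isExtClosed_sCl G p).of_iso ((shiftFunctorCompIsoId C n (-n) (by ring)).app X) ?_
  exact sCl_shift (-n) (fun i hi => (hpq _).2 (by simpa using hi)) hX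

/-- Replacing the generator: if `F P ∈ ⟨G⟩^{[a, b]}`, then `F` maps `⟨P⟩^{[m, ∞)}` to
`⟨G⟩^{[m + a, ∞)}`. -/
lemma map_mem_sCl {D : Type*} [Category* D] [HasZeroObject D] [HasShift D ℤ]
    [Preadditive D] [∀ n : ℤ, (shiftFunctor D n).Additive] [Pretriangulated D]
    (F : C ⥤ D) [F.CommShift ℤ] [F.IsTriangulated] {P X : C} {G : D} {a b m : ℤ}
    (hP : F.obj P ∈ sCl G (fun i => a ≤ i ∧ i ≤ b)) (hX : X ∈ sCl P (fun i => m ≤ i)) :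
    F.obj X ∈ sCl G (fun i => m + a ≤ i) :=
  sCl_subset ((isExtClosed_sCl G _).preimage F) (fun i hi =>
    (isExtClosed_sCl G _).of_iso ((F.commShiftIso (-i)).app P).symm
      (sCl_shift (-i) (fun j hj => by have := hj.1; lia) hP)) hX

/-- Every object of `⟨G⟩` is built from finitely many shifts of `G`. -/
lemma exists_mem_sCl_Icc {G X : C} (hX : X ∈ sCl G (fun _ => True)) :
    ∃ a b : ℤ, a ≤ b ∧ X ∈ sCl G (fun i => a ≤ i ∧ i ≤ b) := by
  refine sCl_subset (Q := {X | ∃ a b : ℤ, a ≤ b ∧ X ∈ sCl G (fun i => a ≤ i ∧ i ≤ b)}) ?_ ?_ hX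
  · constructor
    · exact fun hX => ⟨0, 0, le_rfl, (isExtClosed_sCl G _).zero hX⟩
    · rintro X Y s r hsr ⟨a, b, hab, hY⟩
      exact ⟨a, b, hab, sCl_retract s r hsr hY⟩
    · rintro X Z Y f g h hT ⟨a, b, hab, hX⟩ ⟨a', b', hab', hY⟩
      refine ⟨min a a', max b b', by lia, (isExtClosed_sCl G _).ext f g h hT
        (sCl_mono ?_ hX) (sCl_mono ?_ hY)⟩ <;> intro i hi <;> lia
  · exact fun i _ => ⟨i, i, le_rfl, shift_mem_sCl ⟨le_rfl, le_rfl⟩⟩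

lemma exists_mem_sCl_Icc_width {G X : C} (hX : X ∈ sCl G (fun _ => True)) :
    ∃ a b : ℤ, b - a = (width G X : ℤ) ∧ X ∈ sCl G (fun i => a ≤ i ∧ i ≤ b) := by
  obtain ⟨a, b, hab, h⟩ := exists_mem_sCl_Icc hX
  exact Nat.sInf_mem (s := {d : ℕ | ∃ a b : ℤ, b - a = (d : ℤ) ∧
    X ∈ sCl G (fun i => a ≤ i ∧ i ≤ b)}) ⟨(b - a).toNat, a, b, by lia, h⟩

/-! ### Vanishing of morphisms -/

section Hom

variable {D E : Type*} [Category* D] [Preadditive D] [Category* E] [Preadditive E]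

lemma homZero.of_retract_left {A A' B : D} (h : homZero A' B) (s : A ⟶ A') (r : A' ⟶ A)
    (hsr : s ≫ r = 𝟙 A) : homZero A B := fun f => by
  rw [← Category.id_comp f, ← hsr, Category.assoc, h (r ≫ f), comp_zero]

lemma homZero.of_retract_right {A B B' : D} (h : homZero A B') (s : B ⟶ B') (r : B' ⟶ B)
    (hsr : s ≫ r = 𝟙 B) : homZero A B := fun f => by
  rw [← Category.comp_id f, ← hsr, ← Category.assoc, h (f ≫ s), zero_comp]

lemma homZero.of_iso {A A' B B' : D} (h : homZero A B) (e : A ≅ A') (e' : B ≅ B') :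
    homZero A' B' :=
  (h.of_retract_left e.inv e.hom e.inv_hom_id).of_retract_right e'.inv e'.hom e'.inv_hom_id

lemma homZero.of_map (F : D ⥤ E)
    [F.PreservesZeroMorphisms] [F.Faithful] {A B : D}
    (h : ∀ f : F.obj A ⟶ F.obj B, f = 0) : homZero A B := fun f =>
  F.map_injective (by rw [h (F.map f), F.map_zero])

/-- The objects `X` such that `Hom(G[m], X) = 0` for all `m > N`. -/
def perp [HasShift D ℤ] (G : D) (N : ℤ) : Set D := {X | ∀ m : ℤ, N < m → homZero (G⟦m⟧) X}

lemma perp_mono [HasShift D ℤ] (G : D) {M N : ℤ} (h : M ≤ N) : perp G M ⊆ perp G N :=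
  fun _ hX m hm => hX m (h.trans_lt hm)

lemma perp_shift [HasShift D ℤ] [∀ n : ℤ, (shiftFunctor D n).Additive] {G X : D}
    {M N : ℤ} (n : ℤ) (h : N = M + n) (hX : X ∈ perp G M) :
    X⟦n⟧ ∈ perp G N := fun m hm =>
  homZero.of_map (shiftFunctor D (-n)) <|
    (hX (m - n) (by lia)).of_iso ((shiftFunctorAdd' D m (-n) (m - n) (by ring)).app G)
      ((shiftFunctorCompIsoId D n (-n) (by ring)).app X).symm

end Hom

lemma isExtClosed_homZero_right (A : C) : IsExtClosed {X : C | homZero A X} where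
  zero hX f := hX.eq_of_tgt f 0
  retract s r hsr hY := hY.of_retract_right s r hsr
  ext f g h hT hX hY x := by
    obtain ⟨y, rfl⟩ := exists_lift₂ hT x (hY _)
    rw [hX y, zero_comp]

lemma isExtClosed_homZero_left (B : C) : IsExtClosed {X : C | homZero X B} where
  zero hX f := hX.eq_of_src f 0
  retract s r hsr hY := hY.of_retract_left s r hsr
  ext f g h hT hX hY x := by
    obtain ⟨y, rfl⟩ := exists_desc₂ hT x (hX _)
    rw [hY y, comp_zero]

lemma isExtClosed_perp (G : C) (N : ℤ) : IsExtClosed (perp G N) where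
  zero hX _ _ := (isExtClosed_homZero_right _).zero hX
  retract s r hsr hY m hm := (hY m hm).of_retract_right s r hsr
  ext f g h hT hX hY m hm := (isExtClosed_homZero_right _).ext f g h hT (hX m hm) (hY m hm)

lemma perp_of_mem_sCl_left {G P X : C} {a b N M : ℤ} (hM : M = N + b)
    (hP : P ∈ sCl G (fun i => a ≤ i ∧ i ≤ b)) (hX : X ∈ perp G N) : X ∈ perp P M := fun m hm =>
  sCl_subset ((isExtClosed_homZero_left X).shift_preimage m) (fun i hi =>
    (hX (-i + m) (by lia)).of_iso ((shiftFunctorAdd C (-i) m).app G) (Iso.refl X)) hP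

lemma sCl_subset_perp {G : C} {o : ℤ} (ho : G ∈ perp G o) {m N : ℤ} (hN : N = o - m) :
    sCl G (fun i => m ≤ i) ⊆ perp G N :=
  sCl_subset (isExtClosed_perp G N) fun i hi =>
    perp_mono G (by lia) (perp_shift (-i) rfl ho)

lemma perp_of_map {D : Type*} [Category* D] [HasZeroObject D] [HasShift D ℤ]
    [Preadditive D] [∀ n : ℤ, (shiftFunctor D n).Additive] [Pretriangulated D]
    (F : C ⥤ D) [F.CommShift ℤ] [F.IsTriangulated] [F.Faithful] {G X : C} {N : ℤ}
    (h : F.obj X ∈ perp (F.obj G) N) : X ∈ perp G N := fun m hm =>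
  homZero.of_map F ((h m hm).of_iso ((F.commShiftIso m).app G).symm (Iso.refl _))

lemma perp_of_adj {D : Type*} [Category* D] [Preadditive D] [HasShift D ℤ]
    {E : Type*} [Category* E] [Preadditive E] [HasShift E ℤ]
    (F : D ⥤ E) [F.CommShift ℤ] {F' : E ⥤ D} [F'.PreservesZeroMorphisms] (adj : F ⊣ F')
    {G : D} {X : E} {N : ℤ} (h : X ∈ perp (F.obj G) N) : F'.obj X ∈ perp G N := fun m hm f => by
  have h₀ : (adj.homEquiv _ _).symm f = 0 :=
    (h m hm).of_iso ((F.commShiftIso m).app G).symm (Iso.refl _) _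
  rw [← (adj.homEquiv _ _).apply_symm_apply f, h₀, adj.homEquiv_unit, F'.map_zero, comp_zero]

/-! ### Finitistic dimension -/

/-- The condition in the definition of the finitistic dimension, for `n ∈ ℕ`. -/
def FdLE (G : C) (n : ℕ) : Prop :=
  ∀ X ∈ perp G 0, X ∈ sCl G (fun i => -(n : ℤ) ≤ i)

lemma mem_shiftSet_iff {G X : C} {n : ℤ} :
    X ∈ shiftSet (sCl G (fun i => 0 ≤ i)) n ↔ X ∈ sCl G (fun i => -n ≤ i) := by
  constructor
  · rintro ⟨Y, hY, ⟨e⟩⟩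
    exact (isExtClosed_sCl G _).of_iso e.symm (sCl_shift n (fun i hi => by lia) hY)
  · intro hX
    exact ⟨X⟦-n⟧, sCl_shift (-n) (fun i hi => by lia) hX,
      ⟨((shiftFunctorCompIsoId C (-n) n (by ring)).app X).symm⟩⟩

lemma fd_eq_sInf (G : C) : fd G = sInf {x : EReal | ∃ n : ℕ, x = en n ∧ FdLE G n} := by
  simp only [fd, fdRel, FdLE, mem_shiftSet_iff, Set.mem_univ, true_imp_iff]
  rfl

lemma one_eq_en : (1 : EReal) = en 1 := by simp [en]

lemma top_add_en (n : ℕ) : ⊤ + en n = ⊤ := EReal.top_add_coe _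

lemma en_add_top (n : ℕ) : en n + ⊤ = ⊤ := EReal.coe_add_top _

lemma sInf_en_eq_top_or (p : ℕ → Prop) :
    sInf {x : EReal | ∃ n : ℕ, x = en n ∧ p n} = ⊤ ∨
      ∃ n : ℕ, sInf {x : EReal | ∃ n : ℕ, x = en n ∧ p n} = en n ∧ p n := by
  by_cases h : ∃ n, p n
  · classical
    right
    refine ⟨Nat.find h, IsLeast.csInf_eq ⟨⟨_, rfl, Nat.find_spec h⟩, ?_⟩, Nat.find_spec h⟩
    rintro _ ⟨n, rfl, hn⟩
    exact EReal.coe_le_coe_iff.2 (Nat.cast_le.2 (Nat.find_min' h hn))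
  · left
    push Not at h
    simp [h]

lemma fd_eq_top_or (G : C) : fd G = ⊤ ∨ ∃ n : ℕ, fd G = en n ∧ FdLE G n := by
  rw [fd_eq_sInf]
  exact sInf_en_eq_top_or _

lemma fd_le {G : C} {n : ℕ} (h : FdLE G n) : fd G ≤ en n := by
  rw [fd_eq_sInf]
  exact sInf_le ⟨n, rfl, h⟩

lemma FdLE.mem_sCl {G X : C} {n : ℕ} (h : FdLE G n) {N : ℤ} (hX : X ∈ perp G N) :
    X ∈ sCl G (fun i => -(n + N) ≤ i) :=
  (sCl_shift_iff (-N) (fun i => by lia)).1 (h _ (perp_shift (-N) (by ring) hX))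

lemma exists_oMinus_eq {D : Type*} [Category* D] [Preadditive D] [HasShift D ℤ] {G : D}
    (h : ∃ N : ℤ, ∀ n : ℤ, N ≤ n → homZero (G⟦n⟧) G) :
    ∃ o : ℕ, oMinus G = en o ∧ G ∈ perp G o := by
  obtain ⟨N, hN⟩ := h
  rcases sInf_en_eq_top_or (fun b => ∀ i : ℤ, (b : ℤ) < i → homZero (G⟦i⟧) G) with h | h
  · have hle : oMinus G ≤ en N.toNat := sInf_le ⟨_, rfl, fun i hi => hN i (by lia)⟩
    exact absurd (hle.trans_lt (EReal.coe_lt_top _)) h.not_lt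
  · exact h

/-- Theorem 1.2(1): upper bound for the finitistic dimension of the middle
term of a left recollement of triangulated categories. -/
theorem stmt0
    {R : Type u} [Category.{v} R] [HasZeroObject R] [HasShift R ℤ]
    [Preadditive R] [∀ n : ℤ, (shiftFunctor R n).Additive] [Pretriangulated R]
    {S : Type u} [Category.{v} S] [HasZeroObject S] [HasShift S ℤ]
    [Preadditive S] [∀ n : ℤ, (shiftFunctor S n).Additive] [Pretriangulated S]
    {T : Type u} [Category.{v} T] [HasZeroObject T] [HasShift T ℤ]
    [Preadditive T] [∀ n : ℤ, (shiftFunctor T n).Additive] [Pretriangulated T]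
    (iStar : S ⥤ R) (iLower : R ⥤ S) (jLower : T ⥤ S) (jStar : S ⥤ T)
    [iStar.CommShift ℤ] [iStar.IsTriangulated]
    [iLower.CommShift ℤ] [iLower.IsTriangulated]
    [jLower.CommShift ℤ] [jLower.IsTriangulated]
    [jStar.CommShift ℤ] [jStar.IsTriangulated]
    (adjI : iStar ⊣ iLower) (adjJ : jLower ⊣ jStar)
    [iLower.Full] [iLower.Faithful] [jLower.Full] [jLower.Faithful]
    (hJI : ∀ X : R, IsZero (jStar.obj (iLower.obj X)))
    (hglue : ∀ Y : S, ∃ h : iLower.obj (iStar.obj Y) ⟶ (jLower.obj (jStar.obj Y))⟦(1 : ℤ)⟧,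
      Triangle.mk (adjJ.counit.app Y) (adjI.unit.app Y) h ∈ distTriang S)
    (G_R : R) (G_S : S) (G_T : T)
    (hvan : ∃ N : ℤ, ∀ n : ℤ, N ≤ n → homZero (G_S⟦n⟧) G_S)
    (hiG : iLower.obj G_R ∈ sCl G_S (fun _ => True))
    (hjG : jLower.obj G_T ∈ sCl G_S (fun _ => True)) :
    fd G_S ≤ fd G_R + fd G_T + en (width G_S (iLower.obj G_R)) + en (width G_S (jLower.obj G_T))
        + oMinus G_S + 1 ∧
      (fd G_R < ⊤ → fd G_T < ⊤ → fd G_S < ⊤) := by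
  have hR := fd_eq_top_or G_R
  have hT := fd_eq_top_or G_T
  obtain ⟨o, ho, hoG⟩ := exists_oMinus_eq hvan
  rcases hR with hR | ⟨r, hR, hr⟩
  · rcases hT with hT | ⟨t, hT, ht⟩ <;> simp [hR, hT, ho, one_eq_en, top_add_en]
  rcases hT with hT | ⟨t, hT, ht⟩
  · simp [hR, hT, ho, one_eq_en, top_add_en, en_add_top]
  obtain ⟨a, b, hab, hP⟩ := exists_mem_sCl_Icc_width hjG
  obtain ⟨c, d, hcd, hQ⟩ := exists_mem_sCl_Icc_width hiG
  have key : fd G_S ≤ en (r + t + width G_S (iLower.obj G_R) + width G_S (jLower.obj G_T)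
      + o + 1) := by
    refine fd_le fun X hX => ?_
    obtain ⟨δ, hδ⟩ := hglue X
    have h₁ : jStar.obj X ∈ perp G_T b :=
      perp_of_adj jLower adjJ (perp_of_mem_sCl_left (zero_add b).symm hP hX)
    have h₂ : jLower.obj (jStar.obj X) ∈ sCl G_S (fun i => -(t + b) + a ≤ i) :=
      map_mem_sCl jLower hP (ht.mem_sCl h₁)
    have h₃ : (jLower.obj (jStar.obj X))⟦(1 : ℤ)⟧ ∈
        perp G_S (o + t + width G_S (jLower.obj G_T) + 1) :=
      sCl_subset_perp hoG (m := -(t + b) + a - 1) (by lia)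
        (sCl_shift 1 (fun i hi => by lia) h₂)
    have h₄ : iLower.obj (iStar.obj X) ∈
        perp G_S (o + t + width G_S (jLower.obj G_T) + 1) :=
      (isExtClosed_perp G_S _).ext _ _ _ (mk_rotate hδ) (perp_mono G_S (by lia) hX) h₃
    have h₅ : iStar.obj X ∈ perp G_R (o + t + width G_S (jLower.obj G_T) + 1 + d) :=
      perp_of_map iLower (perp_of_mem_sCl_left rfl hQ h₄)
    have h₆ : iLower.obj (iStar.obj X) ∈ sCl G_S
        (fun i => -(r + (o + t + width G_S (jLower.obj G_T) + 1 + d)) + c ≤ i) :=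
      map_mem_sCl iLower hQ (hr.mem_sCl h₅)
    exact (isExtClosed_sCl G_S _).ext _ _ _ hδ (sCl_mono (fun i hi => by push_cast; lia) h₂)
      (sCl_mono (fun i hi => by push_cast; lia) h₆)
  refine ⟨?_, fun _ _ => key.trans_lt (EReal.coe_lt_top _)⟩
  rw [hR, hT, ho]
  refine key.trans_eq ?_
  simp [en]


end TriFD
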